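/- Let σ be a distortion function and q ∈ (1,∞). Then the simple functions (and hence L^∞(P)) are dense in (L*_{σ,q}(P), |·|*_{σ,q}). -/

import Mathlib

open MeasureTheory
open scoped ENNReal NNReal

noncomputable section

variable {Ω : Type*} [MeasurableSpace Ω]

/-- A `[0,1]`-valued random variable uniformly distributed on `[0,1]`:
`P(U ≤ u) = u` for all `u ∈ [0,1]`. -/
def IsUniformRV (P : Measure Ω) (U : Ω → ℝ) : Prop :=
  Measurable U ∧ (∀ ω, U ω ∈ Set.Icc (0 : ℝ) 1) ∧
    ∀ u ∈ Set.Icc (0 : ℝ) 1, P {ω | U ω ≤ u} = ENNReal.ofReal u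

/-- A distortion function: nondecreasing, nonnegative, left-continuous on `[0,1)`
with `∫₀¹ σ(u) du = 1`. -/
structure IsDistortion (σ : ℝ → ℝ) : Prop where
  nonneg : ∀ u ∈ Set.Ico (0 : ℝ) 1, 0 ≤ σ u
  mono : MonotoneOn σ (Set.Ico (0 : ℝ) 1)
  left_continuous : ∀ u ∈ Set.Ioo (0 : ℝ) 1,
    Filter.Tendsto σ (nhdsWithin u (Set.Iio u)) (nhds (σ u))
  integral_one : ∫ u in Set.Ioo (0 : ℝ) 1, σ u = 1

/-- `‖Y‖_{σ,p}^p := sup over uniform U of E[σ(U)·‖Y‖^p]`. -/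
def sigmaPow (P : Measure Ω) (σ : ℝ → ℝ) (p : ℝ) {X : Type*} [NormedAddCommGroup X]
    (Y : Ω → X) : ℝ≥0∞ :=
  ⨆ (U : Ω → ℝ) (_ : IsUniformRV P U),
    ∫⁻ ω, ENNReal.ofReal (σ (U ω)) * (‖Y ω‖₊ : ℝ≥0∞) ^ p ∂P

/-- The norm `‖Y‖_{σ,p}`. -/
def sigmaNorm (P : Measure Ω) (σ : ℝ → ℝ) (p : ℝ) {X : Type*} [NormedAddCommGroup X]
    (Y : Ω → X) : ℝ≥0∞ :=
  sigmaPow P σ p Y ^ (1 / p)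

/-- Membership in `L_σ^p(P,X)`: strongly measurable with finite `σ,p`-norm. -/
def MemLsigma (P : Measure Ω) (σ : ℝ → ℝ) (p : ℝ) {X : Type*} [NormedAddCommGroup X]
    (Y : Ω → X) : Prop :=
  AEStronglyMeasurable Y P ∧ sigmaPow P σ p Y < ∞

/-- The generalized inverse distribution function (quantile function)
`F_g^{-1}(α) = inf {q : P(g ≤ q) ≥ α}`. -/
def quantileFn (P : Measure Ω) (g : Ω → ℝ) (α : ℝ) : ℝ :=
  sInf {q : ℝ | ENNReal.ofReal α ≤ P {ω | g ω ≤ q}}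

variable {𝕂 : Type*} [RCLike 𝕂]

/-- The Köthe dual of `L_σ^p(P)`:
`{Z measurable : Z·Y ∈ L¹(P) for all Y ∈ L_σ^p(P)}`. -/
def KoetheDual (P : Measure Ω) (σ : ℝ → ℝ) (p : ℝ) (Z : Ω → 𝕂) : Prop :=
  AEStronglyMeasurable Z P ∧
    ∀ Y : Ω → 𝕂, MemLsigma P σ p Y → Integrable (fun ω => Z ω * Y ω) P

/-- The average value-at-risk of level `α` of the (nonnegative) random variable `g`:
`AV@R_α(g) = (1/(1−α)) ∫_α^1 F_g^{-1}(u) du`. -/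
def avar (P : Measure Ω) (g : Ω → ℝ) (α : ℝ) : ℝ≥0∞ :=
  ENNReal.ofReal (1 / (1 - α)) *
    ∫⁻ u in Set.Ioo α 1, ENNReal.ofReal (quantileFn P g u)

/-- `Z'` σ-dominates `Z`: there is a uniform `U` with
`AV@R_α(σ(U)·|Z'|) ≥ AV@R_α(|Z|)` for all `α < 1`. -/
def SigmaDominates (P : Measure Ω) (σ : ℝ → ℝ) (Z' Z : Ω → 𝕂) : Prop :=
  ∃ U : Ω → ℝ, IsUniformRV P U ∧ ∀ α ∈ Set.Ico (0 : ℝ) 1,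
    avar P (fun ω => ‖Z ω‖) α ≤ avar P (fun ω => σ (U ω) * ‖Z' ω‖) α

/-- `|Z|*_{σ,∞} = sup_{α ∈ [0,1)} AV@R_α(|Z|) / ((1/(1−α))·S_σ(α))
 = sup_{α ∈ [0,1)} (∫_α^1 F_{|Z|}^{-1}(u) du) / (∫_α^1 σ(u) du)`. -/
def dualNormInf (P : Measure Ω) (σ : ℝ → ℝ) (Z : Ω → 𝕂) : ℝ≥0∞ :=
  ⨆ (α : ℝ) (_ : α ∈ Set.Ico (0 : ℝ) 1),
    (∫⁻ u in Set.Ioo α 1, ENNReal.ofReal (quantileFn P (fun ω => ‖Z ω‖) u)) /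
      ENNReal.ofReal (∫ u in Set.Ioo α 1, σ u)

/-- `|Z|*_{σ,q} = inf {‖Z'‖_{σ,q} : Z' σ-dominates Z}` (with `inf ∅ = ∞`). -/
def dualNormQ (P : Measure Ω) (σ : ℝ → ℝ) (q : ℝ) (Z : Ω → 𝕂) : ℝ≥0∞ :=
  ⨅ (Z' : Ω → 𝕂) (_ : AEStronglyMeasurable Z' P ∧ SigmaDominates P σ Z' Z),
    sigmaNorm P σ q Z'

section Uniform

variable {P : Measure Ω}

lemma IsUniformRV.map_eq [IsProbabilityMeasure P] {U : Ω → ℝ} (hU : IsUniformRV P U) :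
    P.map U = volume.restrict (Set.Ioo (0 : ℝ) 1) := by
  rw [Measure.restrict_congr_set Ioo_ae_eq_Icc]
  have : IsProbabilityMeasure (P.map U) := Measure.isProbabilityMeasure_map hU.1.aemeasurable
  refine Measure.ext_of_Iic _ _ fun a => ?_
  rw [Measure.map_apply hU.1 measurableSet_Iic, Measure.restrict_apply measurableSet_Iic]
  change P {ω | U ω ≤ a} = _
  rcases lt_or_ge a 0 with ha | ha
  · have h1 : {ω | U ω ≤ a} = ∅ := by
      ext ω; simpa using ha.trans_le (hU.2.1 ω).1
    have h2 : Set.Iic a ∩ Set.Icc (0 : ℝ) 1 = ∅ := by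
      ext x; simp only [Set.mem_inter_iff, Set.mem_Iic, Set.mem_Icc, Set.mem_empty_iff_false,
        iff_false]; intro h; linarith [h.1, h.2.1]
    simp [h1, h2]
  rcases le_or_gt a 1 with ha1 | ha1
  · have h2 : Set.Iic a ∩ Set.Icc (0 : ℝ) 1 = Set.Icc 0 a := by
      ext x; simp only [Set.mem_inter_iff, Set.mem_Iic, Set.mem_Icc]
      constructor
      · rintro ⟨h, h', -⟩; exact ⟨h', h⟩
      · rintro ⟨h, h'⟩; exact ⟨h', h, h'.trans ha1⟩
    rw [h2, hU.2.2 a ⟨ha, ha1⟩]; simp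
  · have h1 : {ω | U ω ≤ a} = Set.univ := by
      ext ω; simpa using (hU.2.1 ω).2.trans ha1.le
    have h2 : Set.Iic a ∩ Set.Icc (0 : ℝ) 1 = Set.Icc 0 1 := by
      ext x; simp only [Set.mem_inter_iff, Set.mem_Iic, Set.mem_Icc, and_iff_right_iff_imp]
      rintro ⟨-, h⟩; exact h.trans ha1.le
    simp [h1, h2]

lemma IsUniformRV.lintegral_comp [IsProbabilityMeasure P] {U : Ω → ℝ} (hU : IsUniformRV P U)
    {f : ℝ → ℝ≥0∞} (hf : Measurable f) :
    ∫⁻ ω, f (U ω) ∂P = ∫⁻ u in Set.Ioo (0 : ℝ) 1, f u := by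
  rw [← hU.map_eq, lintegral_map hf hU.1]

lemma IsUniformRV.measure_eq_zero [IsProbabilityMeasure P] {U : Ω → ℝ} (hU : IsUniformRV P U)
    (c : ℝ) : P {ω | U ω = c} = 0 := by
  have h := Measure.map_apply (μ := P) hU.1 (measurableSet_singleton c)
  rw [hU.map_eq, measure_singleton] at h
  exact h.symm

lemma IsUniformRV.ae_lt_one [IsProbabilityMeasure P] {U : Ω → ℝ} (hU : IsUniformRV P U) :
    ∀ᵐ ω ∂P, U ω < 1 := by
  have h : ∀ᵐ ω ∂P, U ω ≠ 1 := by
    simpa [ae_iff] using hU.measure_eq_zero 1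
  filter_upwards [h] with ω hω
  exact lt_of_le_of_ne (hU.2.1 ω).2 hω

/-- Probability integral transform for laws without atoms. -/
lemma isUniformRV_cdf [IsProbabilityMeasure P] {T : Ω → ℝ} (hT : Measurable T)
    (hatom : ∀ x, P {ω | T ω = x} = 0) :
    IsUniformRV P fun ω => ProbabilityTheory.cdf (P.map T) (T ω) := by
  have : IsProbabilityMeasure (P.map T) := Measure.isProbabilityMeasure_map hT.aemeasurable
  set F := ProbabilityTheory.cdf (P.map T) with hF
  have hFP : ∀ x, ENNReal.ofReal (F x) = P {ω | T ω ≤ x} := fun x => by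
    rw [hF, ProbabilityTheory.ofReal_cdf, Measure.map_apply hT measurableSet_Iic]; rfl
  have hcont : Continuous F := by
    refine continuous_iff_continuousAt.2 fun x => ?_
    rw [F.mono.continuousAt_iff_leftLim_eq_rightLim, F.rightLim_eq]
    have h := F.measure_singleton x
    rw [hF, ProbabilityTheory.measure_cdf, Measure.map_apply hT (measurableSet_singleton x)] at h
    have h0 : P (T ⁻¹' {x}) = 0 := hatom x
    rw [h0, eq_comm, ENNReal.ofReal_eq_zero] at h
    exact le_antisymm (F.mono.leftLim_le le_rfl) (by linarith)
  have hex : ∀ u ∈ Set.Ioo (0 : ℝ) 1, ∃ x, F x = u := fun u hu => by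
    obtain ⟨a, ha⟩ := ((ProbabilityTheory.tendsto_cdf_atBot (P.map T)).eventually_lt_const
      hu.1).exists
    obtain ⟨b, hb⟩ := ((ProbabilityTheory.tendsto_cdf_atTop (P.map T)).eventually_const_lt
      hu.2).exists
    obtain ⟨x, hx⟩ := mem_range_of_exists_le_of_exists_ge hcont ⟨a, ha.le⟩ ⟨b, hb.le⟩
    exact ⟨x, hx⟩
  refine ⟨F.mono.measurable.comp hT, fun ω => ⟨ProbabilityTheory.cdf_nonneg _ _,
    ProbabilityTheory.cdf_le_one _ _⟩, fun u hu => le_antisymm ?_ ?_⟩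
  · rcases eq_or_lt_of_le hu.2 with rfl | hu1
    · simpa using prob_le_one
    · refine le_of_forall_gt_imp_ge_of_dense fun c hc => ?_
      by_cases hc1 : 1 ≤ c
      · exact prob_le_one.trans hc1
      push Not at hc1
      lift c to ℝ≥0 using (hc1.trans ENNReal.one_lt_top).ne
      have hc' : u < c := by
        rw [ENNReal.ofReal_lt_iff_lt_toReal hu.1 ENNReal.coe_ne_top] at hc; simpa using hc
      have hc1' : (c : ℝ) < 1 := by exact_mod_cast hc1
      obtain ⟨x, hx⟩ := hex c ⟨hu.1.trans_lt hc', hc1'⟩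
      have : {ω | F (T ω) ≤ u} ⊆ {ω | T ω ≤ x} := fun ω (hω : F (T ω) ≤ u) => by
        by_contra h
        have := F.mono (not_le.1 h).le
        linarith
      refine (measure_mono this).trans ?_
      rw [← hFP, hx]; simp
  · rcases eq_or_lt_of_le hu.2 with rfl | hu1
    · have : {ω | F (T ω) ≤ 1} = Set.univ := by
        ext ω; simpa using ProbabilityTheory.cdf_le_one _ _
      rw [this]; simp
    rcases eq_or_lt_of_le hu.1 with rfl | hu0
    · simp
    obtain ⟨x, hx⟩ := hex u ⟨hu0, hu1⟩
    rw [← hx, hFP]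
    exact measure_mono fun ω (hω : T ω ≤ x) => F.mono hω

end Uniform

/-- The extension of a distortion function by zero outside `[0,1)`. -/
def sigExt (σ : ℝ → ℝ) : ℝ → ℝ := (Set.Ico (0 : ℝ) 1).indicator σ

section Distortion

variable {σ : ℝ → ℝ}

lemma sigExt_of_mem {u : ℝ} (hu : u ∈ Set.Ico (0 : ℝ) 1) : sigExt σ u = σ u :=
  Set.indicator_of_mem hu _

lemma IsDistortion.sigExt_nonneg (hσ : IsDistortion σ) (u : ℝ) : 0 ≤ sigExt σ u :=
  Set.indicator_nonneg hσ.nonneg u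

lemma IsDistortion.measurable_sigExt (hσ : IsDistortion σ) : Measurable (sigExt σ) := by
  refine measurable_of_restrict_of_restrict_compl (s := Set.Ico (0 : ℝ) 1) measurableSet_Ico ?_ ?_
  · have : (Set.Ico (0 : ℝ) 1).domRestrict (sigExt σ) = (Set.Ico (0 : ℝ) 1).domRestrict σ := by
      ext x; exact sigExt_of_mem x.2
    rw [this]
    have h : Monotone ((Set.Ico (0 : ℝ) 1).domRestrict σ) := fun x y hxy => hσ.mono x.2 y.2 hxy
    exact h.measurable
  · have : (Set.Ico (0 : ℝ) 1)ᶜ.domRestrict (sigExt σ) = fun _ => 0 := by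
      ext x; exact Set.indicator_of_notMem x.2 _
    rw [this]; exact measurable_const

lemma IsDistortion.measurable_ofReal_sigExt (hσ : IsDistortion σ) :
    Measurable fun u => ENNReal.ofReal (sigExt σ u) :=
  hσ.measurable_sigExt.ennreal_ofReal

lemma IsDistortion.lintegral_eq_one (hσ : IsDistortion σ) :
    ∫⁻ u in Set.Ioo (0 : ℝ) 1, ENNReal.ofReal (sigExt σ u) = 1 := by
  have hint : Integrable σ (volume.restrict (Set.Ioo (0 : ℝ) 1)) := by
    by_contra h
    have := hσ.integral_one
    rw [integral_undef h] at this
    exact zero_ne_one this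
  have hnn : 0 ≤ᵐ[volume.restrict (Set.Ioo (0 : ℝ) 1)] σ := by
    filter_upwards [ae_restrict_mem measurableSet_Ioo] with u hu
    exact hσ.nonneg u ⟨hu.1.le, hu.2⟩
  have h := ofReal_integral_eq_lintegral_ofReal hint hnn
  rw [hσ.integral_one, ENNReal.ofReal_one] at h
  rw [h]
  refine setLIntegral_congr_fun measurableSet_Ioo fun u hu => ?_
  rw [sigExt_of_mem ⟨hu.1.le, hu.2⟩]

/-- Upper tails of a distortion function carry at least their Lebesgue mass. -/
lemma IsDistortion.le_lintegral_Ioo (hσ : IsDistortion σ) {α : ℝ} (hα : α ∈ Set.Ico (0 : ℝ) 1) :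
    ENNReal.ofReal (1 - α) ≤ ∫⁻ u in Set.Ioo α 1, ENNReal.ofReal (sigExt σ u) := by
  rcases le_total 1 (σ α) with h | h
  · calc ENNReal.ofReal (1 - α) = ∫⁻ _ in Set.Ioo α 1, 1 := by simp
      _ ≤ _ := by
        refine setLIntegral_mono hσ.measurable_ofReal_sigExt fun u hu => ?_
        have hu' : u ∈ Set.Ico (0 : ℝ) 1 := ⟨hα.1.trans hu.1.le, hu.2⟩
        rw [sigExt_of_mem hu', ENNReal.one_le_ofReal]
        exact h.trans (hσ.mono hα hu' hu.1.le)
  · have hsplit : (1 : ℝ≥0∞) ≤ ENNReal.ofReal α +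
        ∫⁻ u in Set.Ioo α 1, ENNReal.ofReal (sigExt σ u) := by
      calc (1 : ℝ≥0∞) = ∫⁻ u in Set.Ioo (0 : ℝ) 1, ENNReal.ofReal (sigExt σ u) :=
            hσ.lintegral_eq_one.symm
        _ ≤ ∫⁻ u in Set.Ioc 0 α ∪ Set.Ioo α 1, ENNReal.ofReal (sigExt σ u) := by
            refine lintegral_mono_set fun u hu => ?_
            rcases le_or_gt u α with hua | hua
            · exact Or.inl ⟨hu.1, hua⟩
            · exact Or.inr ⟨hua, hu.2⟩
        _ ≤ (∫⁻ u in Set.Ioc 0 α, ENNReal.ofReal (sigExt σ u)) +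
            ∫⁻ u in Set.Ioo α 1, ENNReal.ofReal (sigExt σ u) := lintegral_union_le _ _ _
        _ ≤ _ := by
            gcongr
            calc ∫⁻ u in Set.Ioc 0 α, ENNReal.ofReal (sigExt σ u)
                ≤ ∫⁻ _ in Set.Ioc 0 α, 1 := by
                  refine setLIntegral_mono measurable_const fun u hu => ?_
                  have hu' : u ∈ Set.Ico (0 : ℝ) 1 := ⟨hu.1.le, hu.2.trans_lt hα.2⟩
                  rw [sigExt_of_mem hu', ENNReal.ofReal_le_one]
                  exact (hσ.mono hu' hα hu.2).trans h
              _ = ENNReal.ofReal α := by simp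
    rw [ENNReal.ofReal_sub _ hα.1, ENNReal.ofReal_one]
    exact tsub_le_iff_left.2 hsplit

end Distortion

section Comonotone

variable {P : Measure Ω} [IsProbabilityMeasure P] {σ : ℝ → ℝ}

/-- A uniform random variable comonotone with `N` maximises all integrals of the distortion over
upper level sets of `N`. -/
lemma exists_isUniformRV_comonotone (hσ : IsDistortion σ) (hrich : ∃ U : Ω → ℝ, IsUniformRV P U)
    {N : Ω → ℕ} (hN : Measurable N) :
    ∃ V, IsUniformRV P V ∧ ∀ (k : ℕ) (V' : Ω → ℝ), IsUniformRV P V' →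
      ∫⁻ ω in {ω | k ≤ N ω}, ENNReal.ofReal (sigExt σ (V' ω)) ∂P ≤
        ∫⁻ ω in {ω | k ≤ N ω}, ENNReal.ofReal (sigExt σ (V ω)) ∂P := by
  obtain ⟨U, hU⟩ := hrich
  set T : Ω → ℝ := fun ω => N ω + U ω / 2 with hTdef
  have hT : Measurable T :=
    (measurable_from_top.comp hN : Measurable fun ω => (N ω : ℝ)).add (hU.1.div_const 2)
  have hatom : ∀ x, P {ω | T ω = x} = 0 := fun x => by
    have hsub : {ω | T ω = x} ⊆ ⋃ n : ℕ, {ω | U ω = 2 * (x - n)} := fun ω (hω : _ = x) => by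
      simp only [Set.mem_iUnion, Set.mem_ofPred_eq]
      exact ⟨N ω, by rw [← hω, hTdef]; ring⟩
    exact measure_mono_null hsub (measure_iUnion_null fun n => hU.measure_eq_zero _)
  set V : Ω → ℝ := fun ω => ProbabilityTheory.cdf (P.map T) (T ω) with hVdef
  have hV : IsUniformRV P V := isUniformRV_cdf hT hatom
  have : IsProbabilityMeasure (P.map T) := Measure.isProbabilityMeasure_map hT.aemeasurable
  have hVr : ∀ ω, V ω = P.real {ω' | T ω' ≤ T ω} := fun ω => by
    rw [hVdef]; simp only
    rw [ProbabilityTheory.cdf_eq_real, map_measureReal_apply hT measurableSet_Iic]; rfl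
  refine ⟨V, hV, fun k V' hV' => ?_⟩
  set A : Set Ω := {ω | k ≤ N ω} with hA
  have hAm : MeasurableSet A := hN measurableSet_Ici
  set t : ℝ := P.real Aᶜ with ht
  have hVA : ∀ ω ∈ A, t ≤ V ω := fun ω (hω : k ≤ N ω) => by
    rw [hVr]
    refine measureReal_mono fun ω' hω' => ?_
    simp only [hA, Set.mem_compl_iff, Set.mem_ofPred_eq, not_le] at hω' ⊢
    have h1 : (N ω' : ℝ) + 1 ≤ N ω := by exact_mod_cast hω'.trans_le hω
    have h2 := (hU.2.1 ω').2
    have h3 := (hU.2.1 ω).1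
    simp only [hTdef]; linarith
  have hVAc : ∀ ω ∈ Aᶜ, V ω ≤ t := fun ω hω => by
    rw [hVr]
    refine measureReal_mono fun ω' hω' => ?_
    simp only [hA, Set.mem_compl_iff, Set.mem_ofPred_eq, not_le] at hω hω' ⊢
    have h1 : (N ω : ℝ) + 1 ≤ k := by exact_mod_cast hω
    have h2 := (hU.2.1 ω).2
    have h3 := (hU.2.1 ω').1
    simp only [hTdef] at hω'
    have : (N ω' : ℝ) < k := by linarith
    exact_mod_cast this
  have ht0 : 0 ≤ t := measureReal_nonneg
  rcases eq_or_lt_of_le (measureReal_le_one : t ≤ 1) with ht1 | ht1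
  · have hA0 : P A = 0 := by
      have := probReal_compl_eq_one_sub (μ := P) hAm
      rw [ht1] at this
      have h0 : P.real A = 0 := by linarith
      simpa [Measure.real, ENNReal.toReal_eq_zero_iff] using h0
    rw [setLIntegral_measure_zero _ _ hA0]; exact zero_le
  set c : ℝ≥0∞ := ENNReal.ofReal (sigExt σ t) with hc
  have hm : Measurable fun u => ENNReal.ofReal (sigExt σ u) - c :=
    hσ.measurable_ofReal_sigExt.sub_const c
  have htm : t ∈ Set.Ico (0 : ℝ) 1 := ⟨ht0, ht1⟩
  calc ∫⁻ ω in A, ENNReal.ofReal (sigExt σ (V' ω)) ∂P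
      ≤ ∫⁻ ω in A, (c + (ENNReal.ofReal (sigExt σ (V' ω)) - c)) ∂P :=
        lintegral_mono fun ω => le_add_tsub
    _ = c * P A + ∫⁻ ω in A, (ENNReal.ofReal (sigExt σ (V' ω)) - c) ∂P := by
        rw [lintegral_add_left measurable_const, setLIntegral_const]
    _ ≤ c * P A + ∫⁻ ω, (ENNReal.ofReal (sigExt σ (V' ω)) - c) ∂P := by
        gcongr; exact Measure.restrict_le_self
    _ = c * P A + ∫⁻ ω, (ENNReal.ofReal (sigExt σ (V ω)) - c) ∂P := by
        rw [hV'.lintegral_comp hm, hV.lintegral_comp hm]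
    _ = c * P A + ∫⁻ ω in A, (ENNReal.ofReal (sigExt σ (V ω)) - c) ∂P := by
        rw [← lintegral_add_compl _ hAm]
        have : ∫⁻ ω in Aᶜ, (ENNReal.ofReal (sigExt σ (V ω)) - c) ∂P = 0 := by
          rw [setLIntegral_congr_fun (g := fun _ => 0) hAm.compl, lintegral_zero]
          intro ω hω
          have hVm : V ω ∈ Set.Ico (0 : ℝ) 1 := ⟨(hV.2.1 ω).1, (hVAc ω hω).trans_lt ht1⟩
          simp only
          rw [hc, sigExt_of_mem hVm, sigExt_of_mem htm]
          exact tsub_eq_zero_of_le (ENNReal.ofReal_le_ofReal (hσ.mono hVm htm (hVAc ω hω)))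
        rw [this, add_zero]
    _ = ∫⁻ ω in A, (c + (ENNReal.ofReal (sigExt σ (V ω)) - c)) ∂P := by
        rw [lintegral_add_left measurable_const, setLIntegral_const]
    _ = ∫⁻ ω in A, ENNReal.ofReal (sigExt σ (V ω)) ∂P := by
        refine lintegral_congr_ae ?_
        filter_upwards [ae_restrict_of_ae hV.ae_lt_one, ae_restrict_mem hAm] with ω h1 hω
        have hVm : V ω ∈ Set.Ico (0 : ℝ) 1 := ⟨(hV.2.1 ω).1, h1⟩
        refine add_tsub_cancel_of_le ?_
        rw [hc, sigExt_of_mem hVm, sigExt_of_mem htm]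
        exact ENNReal.ofReal_le_ofReal (hσ.mono htm hVm (hVA ω hω))

end Comonotone

section UniformIntegrability

lemma lintegral_mul_sum_range {P : Measure Ω} (N : Ω → ℕ) (hN : Measurable N) {f : Ω → ℝ≥0∞}
    (hf : Measurable f) (c : ℕ → ℝ≥0∞) :
    ∫⁻ ω, f ω * ∑ k ∈ Finset.range (N ω + 1), c k ∂P =
      ∑' k, (∫⁻ ω in {ω | k ≤ N ω}, f ω ∂P) * c k := by
  have hm : ∀ k, MeasurableSet {ω | k ≤ N ω} := fun k => hN measurableSet_Ici
  have h : ∀ ω, f ω * ∑ k ∈ Finset.range (N ω + 1), c k =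
      ∑' k, {ω | k ≤ N ω}.indicator f ω * c k := fun ω => by
    rw [tsum_eq_sum (s := Finset.range (N ω + 1)), Finset.mul_sum]
    · refine Finset.sum_congr rfl fun k hk => ?_
      rw [Set.indicator_of_mem]
      exact Nat.lt_succ_iff.1 (Finset.mem_range.1 hk)
    · intro k hk
      rw [Set.indicator_of_notMem, zero_mul]
      simpa [Nat.lt_succ_iff] using hk
  simp_rw [h]
  rw [lintegral_tsum fun k => ((hf.indicator (hm k)).mul_const _).aemeasurable]
  congr 1; ext k
  rw [lintegral_mul_const _ (hf.indicator (hm k)), lintegral_indicator (hm k)]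

variable {P : Measure Ω} [IsProbabilityMeasure P] {σ : ℝ → ℝ}

lemma tendsto_measure_le_natCast {N : Ω → ℕ} (hN : Measurable N) :
    Filter.Tendsto (fun k : ℕ => P {ω | k ≤ N ω}) Filter.atTop (nhds 0) := by
  have h := tendsto_measure_iInter_atTop (μ := P) (s := fun k : ℕ => {ω | k ≤ N ω})
    (fun k => (hN measurableSet_Ici).nullMeasurableSet)
    (fun a b hab ω (hω : b ≤ N ω) => hab.trans hω) ⟨0, measure_ne_top _ _⟩
  have h0 : ⋂ k : ℕ, {ω | k ≤ N ω} = ∅ := by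
    ext ω
    simp only [Set.mem_iInter, Set.mem_ofPred_eq, Set.mem_empty_iff_false, iff_false, not_forall,
      not_le]
    exact ⟨N ω + 1, Nat.lt_succ_self _⟩
  rwa [h0, measure_empty] at h

lemma exists_forall_setLIntegral_sigExt_le (hσ : IsDistortion σ)
    (hrich : ∃ U : Ω → ℝ, IsUniformRV P U) {N : Ω → ℕ} (hN : Measurable N) {η : ℝ≥0∞}
    (hη : η ≠ 0) :
    ∃ m : ℕ, ∀ V' : Ω → ℝ, IsUniformRV P V' →
      ∫⁻ ω in {ω | m ≤ N ω}, ENNReal.ofReal (sigExt σ (V' ω)) ∂P ≤ η := by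
  obtain ⟨V, hV, hmax⟩ := exists_isUniformRV_comonotone hσ hrich hN
  have hfin : ∫⁻ ω, ENNReal.ofReal (sigExt σ (V ω)) ∂P ≠ ∞ := by
    rw [hV.lintegral_comp hσ.measurable_ofReal_sigExt, hσ.lintegral_eq_one]; simp
  have ht := tendsto_setLIntegral_zero hfin (tendsto_measure_le_natCast (P := P) hN)
  obtain ⟨m, hm⟩ := (ht.eventually_lt_const (pos_iff_ne_zero.2 hη)).exists
  exact ⟨m, fun V' hV' => (hmax m V' hV').trans hm.le⟩

lemma exists_forall_setLIntegral_sigExt_mul_floor_le (hσ : IsDistortion σ)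
    (hrich : ∃ U : Ω → ℝ, IsUniformRV P U) {Y : Ω → ℝ≥0} (hY : Measurable Y)
    (hfin : ∀ V, IsUniformRV P V → ∫⁻ ω, ENNReal.ofReal (sigExt σ (V ω)) * Y ω ∂P ≠ ∞)
    {η : ℝ≥0∞} (hη : η ≠ 0) :
    ∃ K : ℕ, ∀ V' : Ω → ℝ, IsUniformRV P V' →
      ∫⁻ ω in {ω | K ≤ ⌊Y ω⌋₊}, ENNReal.ofReal (sigExt σ (V' ω)) * Y ω ∂P ≤ η := by
  set N : Ω → ℕ := fun ω => ⌊Y ω⌋₊ with hNdef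
  have hN : Measurable N := Nat.measurable_floor.comp hY
  obtain ⟨V, hV, hmax⟩ := exists_isUniformRV_comonotone hσ hrich hN
  have hfin' : ∫⁻ ω, 2 * (ENNReal.ofReal (sigExt σ (V ω)) * Y ω) ∂P ≠ ∞ := by
    rw [lintegral_const_mul' _ _ (by simp)]
    exact ENNReal.mul_ne_top (by simp) (hfin V hV)
  have ht := tendsto_setLIntegral_zero hfin' (tendsto_measure_le_natCast (P := P) hN)
  obtain ⟨K, hK, hK1⟩ := ((ht.eventually_lt_const (pos_iff_ne_zero.2 hη)).and
    (Filter.eventually_ge_atTop 1)).exists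
  refine ⟨K, fun V' hV' => ?_⟩
  have hmK : MeasurableSet {ω | K ≤ N ω} := hN measurableSet_Ici
  set c : ℕ → ℝ≥0∞ := fun k => if k < K then 0 else if k = K then K + 1 else 1 with hc
  have hφ : ∀ n, ∑ k ∈ Finset.range (n + 1), c k = if n < K then 0 else (n : ℝ≥0∞) + 1 := by
    intro n
    induction n with
    | zero => simp [hc, show 0 < K by omega]
    | succ n ih =>
      rw [Finset.sum_range_succ, ih]
      simp only [hc]
      rcases lt_trichotomy (n + 1) K with h | h | h
      · simp [h, show n < K by omega]
      · subst h; simp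
      · simp [show ¬ n < K by omega, show ¬ n + 1 < K by omega, show n + 1 ≠ K by omega]
  have hs : ∀ W : Ω → ℝ, IsUniformRV P W →
      Measurable fun ω => ENNReal.ofReal (sigExt σ (W ω)) := fun W hW =>
    hσ.measurable_ofReal_sigExt.comp hW.1
  calc ∫⁻ ω in {ω | K ≤ N ω}, ENNReal.ofReal (sigExt σ (V' ω)) * Y ω ∂P
      ≤ ∫⁻ ω, ENNReal.ofReal (sigExt σ (V' ω)) * ∑ k ∈ Finset.range (N ω + 1), c k ∂P := by
        rw [← lintegral_indicator hmK]
        refine lintegral_mono fun ω => ?_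
        refine Set.indicator_apply_le' (fun (hω : K ≤ N ω) => ?_) fun _ => zero_le
        rw [hφ, if_neg (not_lt.2 hω)]
        gcongr
        calc (Y ω : ℝ≥0∞) ≤ ((N ω + 1 : ℝ≥0) : ℝ≥0∞) :=
              ENNReal.coe_le_coe.2 (Nat.lt_floor_add_one (Y ω)).le
          _ = N ω + 1 := by simp
    _ ≤ ∫⁻ ω, ENNReal.ofReal (sigExt σ (V ω)) * ∑ k ∈ Finset.range (N ω + 1), c k ∂P := by
        rw [lintegral_mul_sum_range N hN (hs V' hV'), lintegral_mul_sum_range N hN (hs V hV)]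
        exact ENNReal.tsum_le_tsum fun k => mul_le_mul_left (hmax k V' hV') _
    _ ≤ ∫⁻ ω in {ω | K ≤ N ω}, 2 * (ENNReal.ofReal (sigExt σ (V ω)) * Y ω) ∂P := by
        rw [← lintegral_indicator hmK]
        refine lintegral_mono fun ω => ?_
        simp only [hφ]
        by_cases hω : K ≤ N ω
        · rw [Set.indicator_of_mem (show ω ∈ {ω | K ≤ N ω} from hω), if_neg (not_lt.2 hω),
            mul_left_comm]
          gcongr
          have h1 : (N ω : ℝ≥0) ≤ Y ω := Nat.floor_le zero_le
          have h2 : (1 : ℝ≥0) ≤ N ω := by exact_mod_cast hK1.trans hω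
          have h3 : (N ω : ℝ≥0) + 1 ≤ 2 * Y ω := by
            rw [two_mul]; exact add_le_add h1 (h2.trans h1)
          exact_mod_cast h3
        · simp [not_le.1 hω]
    _ ≤ η := hK.le

/-- A distortion norm being finite forces uniform integrability over all uniform weights. -/
lemma exists_forall_setLIntegral_sigExt_mul_le (hσ : IsDistortion σ)
    (hrich : ∃ U : Ω → ℝ, IsUniformRV P U) {Y : Ω → ℝ≥0} (hY : Measurable Y)
    (hfin : ∀ V, IsUniformRV P V → ∫⁻ ω, ENNReal.ofReal (sigExt σ (V ω)) * Y ω ∂P ≠ ∞)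
    {N : Ω → ℕ} (hN : Measurable N) {η : ℝ≥0∞} (hη : η ≠ 0) :
    ∃ m : ℕ, ∀ V' : Ω → ℝ, IsUniformRV P V' →
      ∫⁻ ω in {ω | m ≤ N ω}, ENNReal.ofReal (sigExt σ (V' ω)) * Y ω ∂P ≤ η := by
  have hη2 : η / 2 ≠ 0 := (ENNReal.half_pos hη).ne'
  obtain ⟨K, hK⟩ := exists_forall_setLIntegral_sigExt_mul_floor_le hσ hrich hY hfin hη2
  obtain ⟨m, hm⟩ := exists_forall_setLIntegral_sigExt_le hσ hrich hN
    (η := η / 2 / (K + 1)) (ENNReal.div_ne_zero.2 ⟨hη2, by simp⟩)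
  refine ⟨m, fun V' hV' => ?_⟩
  have hYK : MeasurableSet {ω | K ≤ ⌊Y ω⌋₊} :=
    (Nat.measurable_floor.comp hY) measurableSet_Ici
  have hmm : MeasurableSet {ω | m ≤ N ω} := hN measurableSet_Ici
  have hs : Measurable fun ω => ENNReal.ofReal (sigExt σ (V' ω)) :=
    hσ.measurable_ofReal_sigExt.comp hV'.1
  have hsY : Measurable fun ω => ENNReal.ofReal (sigExt σ (V' ω)) * Y ω :=
    hs.mul hY.coe_nnreal_ennreal
  calc ∫⁻ ω in {ω | m ≤ N ω}, ENNReal.ofReal (sigExt σ (V' ω)) * Y ω ∂P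
      ≤ ∫⁻ ω, ({ω | K ≤ ⌊Y ω⌋₊}.indicator (fun ω => ENNReal.ofReal (sigExt σ (V' ω)) * Y ω) ω +
          {ω | m ≤ N ω}.indicator (fun ω => ENNReal.ofReal (sigExt σ (V' ω)) * (K + 1)) ω) ∂P := by
        rw [← lintegral_indicator hmm]
        refine lintegral_mono fun ω => ?_
        refine Set.indicator_apply_le' (fun hω => ?_) fun _ => zero_le
        by_cases h : K ≤ ⌊Y ω⌋₊
        · rw [Set.indicator_of_mem (show ω ∈ {ω | K ≤ ⌊Y ω⌋₊} from h)]
          exact le_self_add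
        · rw [Set.indicator_of_mem hω]
          refine le_add_left ?_
          gcongr
          have h1 : Y ω < ⌊Y ω⌋₊ + 1 := Nat.lt_floor_add_one _
          have h2 : (⌊Y ω⌋₊ : ℝ≥0) ≤ K := by exact_mod_cast (not_le.1 h).le
          have h3 : Y ω ≤ K + 1 := h1.le.trans (by gcongr)
          calc (Y ω : ℝ≥0∞) ≤ ((K + 1 : ℝ≥0) : ℝ≥0∞) := ENNReal.coe_le_coe.2 h3
            _ = K + 1 := by simp
    _ = (∫⁻ ω in {ω | K ≤ ⌊Y ω⌋₊}, ENNReal.ofReal (sigExt σ (V' ω)) * Y ω ∂P) +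
          (∫⁻ ω in {ω | m ≤ N ω}, ENNReal.ofReal (sigExt σ (V' ω)) ∂P) * (K + 1) := by
        rw [lintegral_add_left (hsY.indicator hYK),
          lintegral_indicator hYK, lintegral_indicator hmm, lintegral_mul_const _ hs]
    _ ≤ η / 2 + η / 2 / (K + 1) * (K + 1) := by
        gcongr
        · exact hK V' hV'
        · exact hm V' hV'
    _ = η := by
        rw [ENNReal.div_mul_cancel (by simp) (by simp), ENNReal.add_halves]

end UniformIntegrability

section Quantile

variable {P : Measure Ω}

lemma quantileFn_congr {f g : Ω → ℝ} (h : f =ᵐ[P] g) (u : ℝ) :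
    quantileFn P f u = quantileFn P g u := by
  unfold quantileFn
  congr 1
  ext x
  have : P {ω | f ω ≤ x} = P {ω | g ω ≤ x} := by
    refine measure_congr ?_
    filter_upwards [h] with ω hω
    exact propext (by change f ω ≤ x ↔ g ω ≤ x; rw [hω])
  simp only [Set.mem_ofPred_eq, this]

lemma avar_congr {f g : Ω → ℝ} (h : f =ᵐ[P] g) (α : ℝ) : avar P f α = avar P g α := by
  unfold avar
  simp_rw [quantileFn_congr h]

lemma quantileFn_le {g : Ω → ℝ} (hg : ∀ᵐ ω ∂P, 0 ≤ g ω) {u x : ℝ} (hu : 0 < u)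
    (hx : ENNReal.ofReal u ≤ P {ω | g ω ≤ x}) : quantileFn P g u ≤ x := by
  refine csInf_le ⟨0, fun y (hy : ENNReal.ofReal u ≤ P {ω | g ω ≤ y}) => ?_⟩ hx
  by_contra! h
  have h0 : P {ω | g ω ≤ y} = 0 := by
    refine measure_mono_null (t := {ω | ¬ 0 ≤ g ω}) (fun ω (hω : g ω ≤ y) => ?_) hg
    exact not_le.2 (hω.trans_lt h)
  rw [h0, nonpos_iff_eq_zero, ENNReal.ofReal_eq_zero] at hy
  linarith

lemma tendsto_measure_le_natCast_atTop [IsProbabilityMeasure P] (g : Ω → ℝ) :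
    Filter.Tendsto (fun n : ℕ => P {ω | g ω ≤ n}) Filter.atTop (nhds 1) := by
  have h := tendsto_measure_iUnion_atTop (μ := P) (s := fun n : ℕ => {ω | g ω ≤ n})
    (fun a b hab ω (hω : g ω ≤ a) => hω.trans (by exact_mod_cast hab))
  have h1 : ⋃ n : ℕ, {ω | g ω ≤ n} = Set.univ := by
    ext ω
    simpa using exists_nat_ge (g ω)
  rwa [h1, measure_univ] at h

lemma le_quantileFn [IsProbabilityMeasure P] {g : Ω → ℝ} {u c : ℝ} (hu : u < 1)
    (hc : ∀ x, ENNReal.ofReal u ≤ P {ω | g ω ≤ x} → c ≤ x) : c ≤ quantileFn P g u := by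
  refine le_csInf ?_ fun x hx => hc x hx
  obtain ⟨n, hn⟩ := ((tendsto_measure_le_natCast_atTop (P := P) g).eventually_const_lt
    (show ENNReal.ofReal u < 1 by simpa using hu)).exists
  exact ⟨n, hn.le⟩

lemma avar_le_avar_iff {f g : Ω → ℝ} {α : ℝ} (hα : α < 1) :
    avar P f α ≤ avar P g α ↔
      ∫⁻ u in Set.Ioo α 1, ENNReal.ofReal (quantileFn P f u) ≤
        ∫⁻ u in Set.Ioo α 1, ENNReal.ofReal (quantileFn P g u) := by
  unfold avar
  refine ENNReal.mul_le_mul_iff_right ?_ ENNReal.ofReal_ne_top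
  have : 0 < 1 / (1 - α) := by
    have : 0 < 1 - α := by linarith
    positivity
  simpa using this

variable [IsProbabilityMeasure P]

lemma setLIntegral_quantileFn_le {f g : Ω → ℝ}
    (hg0 : ∀ᵐ ω ∂P, 0 ≤ g ω) {δ n : ℝ} (h1 : ∀ᵐ ω ∂P, f ω ≤ n → g ω ≤ δ)
    (h2 : ∀ᵐ ω ∂P, g ω ≤ f ω + δ) {α : ℝ} (hα : 0 ≤ α) :
    ∫⁻ u in Set.Ioo α 1, ENNReal.ofReal (quantileFn P g u) ≤
      ENNReal.ofReal δ * ENNReal.ofReal (1 - α) +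
        ∫⁻ u in Set.Ioo (max α (P.real {ω | f ω ≤ n})) 1,
          ENNReal.ofReal (quantileFn P f u) := by
  set β := P.real {ω | f ω ≤ n} with hβ
  calc ∫⁻ u in Set.Ioo α 1, ENNReal.ofReal (quantileFn P g u)
      ≤ ∫⁻ u in Set.Ioo α 1, (ENNReal.ofReal δ +
          (Set.Ioi β).indicator (fun u => ENNReal.ofReal (quantileFn P f u)) u) := by
        refine setLIntegral_mono' measurableSet_Ioo fun u hu => ?_
        have hu0 : 0 < u := hα.trans_lt hu.1
        rcases le_or_gt u β with hub | hub
        · refine le_add_right (ENNReal.ofReal_le_ofReal (quantileFn_le hg0 hu0 ?_))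
          have : ENNReal.ofReal u ≤ P {ω | f ω ≤ n} := by
            rw [← ofReal_measureReal (μ := P)]; exact ENNReal.ofReal_le_ofReal hub
          exact this.trans (measure_mono_ae h1)
        · rw [Set.indicator_of_mem (show u ∈ Set.Ioi β from hub)]
          refine le_trans (ENNReal.ofReal_le_ofReal ?_) ENNReal.ofReal_add_le
          rw [← sub_le_iff_le_add']
          refine le_quantileFn hu.2 fun x hx => ?_
          rw [sub_le_iff_le_add]
          refine quantileFn_le hg0 hu0 (hx.trans (measure_mono_ae ?_))
          filter_upwards [h2] with ω hω (hx : f ω ≤ x)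
          change g ω ≤ x + δ
          linarith
    _ = _ := by
        rw [lintegral_add_left measurable_const, setLIntegral_const, Real.volume_Ioo,
          lintegral_indicator measurableSet_Ioi, Measure.restrict_restrict measurableSet_Ioi]
        congr 3
        ext u
        simp only [Set.mem_inter_iff, Set.mem_Ioi, Set.mem_Ioo, max_lt_iff]
        tauto

lemma le_setLIntegral_quantileFn {X h : Ω → ℝ} (hX0 : ∀ᵐ ω ∂P, 0 ≤ X ω) {m : ℝ}
    (h3 : ∀ᵐ ω ∂P, m < X ω → 2 * X ω ≤ h ω) {α : ℝ} (hα : 0 ≤ α) :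
    2 * ∫⁻ u in Set.Ioo (max α (P.real {ω | X ω ≤ m})) 1, ENNReal.ofReal (quantileFn P X u) ≤
      ∫⁻ u in Set.Ioo α 1, ENNReal.ofReal (quantileFn P h u) := by
  set β := P.real {ω | X ω ≤ m} with hβ
  calc 2 * ∫⁻ u in Set.Ioo (max α β) 1, ENNReal.ofReal (quantileFn P X u)
      = ∫⁻ u in Set.Ioo (max α β) 1, 2 * ENNReal.ofReal (quantileFn P X u) :=
        (lintegral_const_mul' _ _ (by simp)).symm
    _ ≤ ∫⁻ u in Set.Ioo (max α β) 1, ENNReal.ofReal (quantileFn P h u) := by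
        refine setLIntegral_mono' measurableSet_Ioo fun u hu => ?_
        have hua := max_lt_iff.1 hu.1
        have hu0 : 0 < u := hα.trans_lt hua.1
        have h2 : (2 : ℝ≥0∞) = ENNReal.ofReal 2 := by simp
        rw [h2, ← ENNReal.ofReal_mul (by norm_num)]
        refine ENNReal.ofReal_le_ofReal (le_quantileFn hu.2 fun x hx => ?_)
        have hsub : P {ω | h ω ≤ x} ≤ P {ω | X ω ≤ max m (x / 2)} := by
          refine measure_mono_ae ?_
          filter_upwards [h3] with ω hω (hx : h ω ≤ x)
          change X ω ≤ max m (x / 2)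
          rcases le_or_gt (X ω) m with hm | hm
          · exact hm.trans (le_max_left _ _)
          · exact le_trans (by linarith [hω hm]) (le_max_right _ _)
        rcases le_total (x / 2) m with hxm | hxm
        · rw [max_eq_left hxm, ← ofReal_measureReal (μ := P) (s := {ω | X ω ≤ m}), ← hβ] at hsub
          have := (ENNReal.ofReal_le_ofReal_iff measureReal_nonneg).1 (hx.trans hsub)
          exact absurd hua.2 (not_lt.2 this)
        · rw [max_eq_right hxm] at hsub
          linarith [quantileFn_le hX0 hu0 (hx.trans hsub)]
    _ ≤ _ := lintegral_mono_set (Set.Ioo_subset_Ioo_left (le_max_left _ _))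

lemma le_setLIntegral_quantileFn_of_sigExt_le {σ : ℝ → ℝ} (hσ : IsDistortion σ) {U : Ω → ℝ}
    (hU : IsUniformRV P U) {h : Ω → ℝ} {c : ℝ} (hc : 0 < c)
    (h4 : ∀ᵐ ω ∂P, c * sigExt σ (U ω) ≤ h ω) {α : ℝ} (hα : α ∈ Set.Ico (0 : ℝ) 1) :
    ENNReal.ofReal c * ENNReal.ofReal (1 - α) ≤
      ∫⁻ u in Set.Ioo α 1, ENNReal.ofReal (quantileFn P h u) := by
  calc ENNReal.ofReal c * ENNReal.ofReal (1 - α)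
      ≤ ENNReal.ofReal c * ∫⁻ u in Set.Ioo α 1, ENNReal.ofReal (sigExt σ u) := by
        gcongr; exact hσ.le_lintegral_Ioo hα
    _ = ∫⁻ u in Set.Ioo α 1, ENNReal.ofReal c * ENNReal.ofReal (sigExt σ u) :=
        (lintegral_const_mul' _ _ (by simp)).symm
    _ ≤ _ := by
        refine setLIntegral_mono' measurableSet_Ioo fun u hu => ?_
        have hu0 : 0 < u := hα.1.trans_lt hu.1
        rw [← ENNReal.ofReal_mul hc.le, sigExt_of_mem ⟨hu0.le, hu.2⟩]
        refine ENNReal.ofReal_le_ofReal (le_quantileFn hu.2 fun x hx => ?_)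
        by_contra! hlt
        have hσx : x / c < σ u := by rwa [div_lt_iff₀' hc]
        obtain ⟨v, hv, hv0, hvu⟩ := (((hσ.left_continuous u ⟨hu0, hu.2⟩).eventually_const_lt
          hσx).and (Ioo_mem_nhdsLT hu0)).exists
        have hv1 : v < 1 := hvu.trans hu.2
        have hsub : P {ω | h ω ≤ x} ≤ P {ω | U ω ≤ v} := by
          refine measure_mono_ae ?_
          filter_upwards [h4, hU.ae_lt_one] with ω hω hω1 (hx : h ω ≤ x)
          change U ω ≤ v
          by_contra! hvU
          have hUm : U ω ∈ Set.Ico (0 : ℝ) 1 := ⟨(hU.2.1 ω).1, hω1⟩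
          rw [sigExt_of_mem hUm] at hω
          have := hσ.mono ⟨hv0.le, hv1⟩ hUm hvU.le
          rw [div_lt_iff₀' hc] at hv
          nlinarith
        rw [hU.2.2 v ⟨hv0.le, hv1.le⟩] at hsub
        have := (ENNReal.ofReal_le_ofReal_iff hv0.le).1 (hx.trans hsub)
        linarith

lemma exists_measure_le_of_quantile_dominated {f X : Ω → ℝ} (hf : AEMeasurable f P)
    (hX0 : ∀ᵐ ω ∂P, 0 ≤ X ω)
    (hdom : ∀ α ∈ Set.Ico (0 : ℝ) 1,
      ∫⁻ u in Set.Ioo α 1, ENNReal.ofReal (quantileFn P f u) ≤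
        ∫⁻ u in Set.Ioo α 1, ENNReal.ofReal (quantileFn P X u))
    {m : ℝ} (hm : 0 ≤ m) :
    ∃ n : ℝ, P {ω | X ω ≤ m} ≤ P {ω | f ω ≤ n} := by
  rcases (prob_le_one : P {ω | X ω ≤ m} ≤ 1).lt_or_eq with h | h
  · obtain ⟨n, hn⟩ := ((tendsto_measure_le_natCast_atTop (P := P) f).eventually_const_lt h).exists
    exact ⟨n, hn.le⟩
  refine ⟨m, ?_⟩
  have hnull : P {ω | m < f ω} = 0 := by
    have hU : {ω | m < f ω} ⊆ ⋃ j : ℕ, {ω | m + 1 / ((j : ℝ) + 1) < f ω} := fun ω hω => by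
      obtain ⟨j, hj⟩ := exists_nat_one_div_lt (sub_pos.2 (show m < f ω from hω))
      simp only [Set.mem_iUnion, Set.mem_ofPred_eq]
      exact ⟨j, by linarith⟩
    refine measure_mono_null hU (measure_iUnion_null fun j => ?_)
    set k : ℝ := m + 1 / ((j : ℝ) + 1) with hk
    have hmk : m < k := by
      have : 0 < 1 / ((j : ℝ) + 1) := by positivity
      linarith
    by_contra hne
    set α := P.real {ω | f ω ≤ k} with hα
    have hα1 : α < 1 := by
      have hms : NullMeasurableSet {ω | f ω ≤ k} P := nullMeasurableSet_le hf aemeasurable_const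
      refine lt_of_le_of_ne measureReal_le_one fun h1 => hne ?_
      have hc := prob_compl_eq_one_sub₀ hms
      have h1' : P {ω | f ω ≤ k} = 1 := by
        rw [← ofReal_measureReal (μ := P), ← hα, h1, ENNReal.ofReal_one]
      rw [h1', tsub_self] at hc
      convert hc using 2
      ext ω; simp
    have hα0 : 0 ≤ α := measureReal_nonneg
    have hlow : ENNReal.ofReal k * ENNReal.ofReal (1 - α) ≤
        ∫⁻ u in Set.Ioo α 1, ENNReal.ofReal (quantileFn P f u) := by
      rw [← Real.volume_Ioo, ← setLIntegral_const]
      refine setLIntegral_mono' measurableSet_Ioo fun u hu => ENNReal.ofReal_le_ofReal ?_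
      refine le_quantileFn hu.2 fun x hx => ?_
      by_contra! hxk
      have h1 : P {ω | f ω ≤ x} ≤ ENNReal.ofReal α := by
        rw [hα, ofReal_measureReal]
        exact measure_mono fun ω (hω : f ω ≤ x) => hω.trans hxk.le
      have := (ENNReal.ofReal_le_ofReal_iff hα0).1 (hx.trans h1)
      linarith [hu.1]
    have hup : ∫⁻ u in Set.Ioo α 1, ENNReal.ofReal (quantileFn P X u) ≤
        ENNReal.ofReal m * ENNReal.ofReal (1 - α) := by
      rw [← Real.volume_Ioo, ← setLIntegral_const]
      refine setLIntegral_mono' measurableSet_Ioo fun u hu => ENNReal.ofReal_le_ofReal ?_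
      refine quantileFn_le hX0 (hα0.trans_lt hu.1) ?_
      rw [h]
      simpa using hu.2.le
    have hle := (hlow.trans (hdom α ⟨hα0, hα1⟩)).trans hup
    rw [← ENNReal.ofReal_mul (hm.trans hmk.le), ← ENNReal.ofReal_mul hm,
      ENNReal.ofReal_le_ofReal_iff (mul_nonneg hm (by linarith))] at hle
    nlinarith
  rw [h]
  have hae : ∀ᵐ ω ∂P, f ω ≤ m := by simpa [ae_iff] using hnull
  have : P {ω | f ω ≤ m} = P Set.univ := measure_congr (by
    filter_upwards [hae] with ω hω
    exact propext ⟨fun _ => trivial, fun _ => hω⟩)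
  rw [this, measure_univ]

lemma setLIntegral_quantileFn_le_of_dominated {σ : ℝ → ℝ} (hσ : IsDistortion σ) {U : Ω → ℝ}
    (hU : IsUniformRV P U) {f g h X : Ω → ℝ}
    (hg0 : ∀ᵐ ω ∂P, 0 ≤ g ω) (hX0 : ∀ᵐ ω ∂P, 0 ≤ X ω) {δ n m : ℝ} (hδ : 0 < δ)
    (h1 : ∀ᵐ ω ∂P, f ω ≤ n → g ω ≤ δ) (h2 : ∀ᵐ ω ∂P, g ω ≤ f ω + δ)
    (h3 : ∀ᵐ ω ∂P, m < X ω → 2 * X ω ≤ h ω)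
    (h4 : ∀ᵐ ω ∂P, 2 * δ * sigExt σ (U ω) ≤ h ω)
    (hnm : P {ω | X ω ≤ m} ≤ P {ω | f ω ≤ n})
    (hdom : ∀ α ∈ Set.Ico (0 : ℝ) 1,
      ∫⁻ u in Set.Ioo α 1, ENNReal.ofReal (quantileFn P f u) ≤
        ∫⁻ u in Set.Ioo α 1, ENNReal.ofReal (quantileFn P X u))
    {α : ℝ} (hα : α ∈ Set.Ico (0 : ℝ) 1) :
    ∫⁻ u in Set.Ioo α 1, ENNReal.ofReal (quantileFn P g u) ≤
      ∫⁻ u in Set.Ioo α 1, ENNReal.ofReal (quantileFn P h u) := by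
  have hβ : P.real {ω | X ω ≤ m} ≤ P.real {ω | f ω ≤ n} :=
    ENNReal.toReal_mono (measure_ne_top _ _) hnm
  have ha := le_setLIntegral_quantileFn_of_sigExt_le hσ hU (by positivity) h4 hα
  rw [ENNReal.ofReal_mul (by norm_num), mul_assoc, show ENNReal.ofReal 2 = 2 by simp] at ha
  have hb := le_setLIntegral_quantileFn hX0 h3 hα.1
  have hc : ∫⁻ u in Set.Ioo (max α (P.real {ω | f ω ≤ n})) 1, ENNReal.ofReal (quantileFn P f u) ≤
      ∫⁻ u in Set.Ioo (max α (P.real {ω | X ω ≤ m})) 1, ENNReal.ofReal (quantileFn P X u) := by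
    rcases lt_or_ge (max α (P.real {ω | f ω ≤ n})) 1 with hlt | hge
    · exact (hdom _ ⟨hα.1.trans (le_max_left _ _), hlt⟩).trans
        (lintegral_mono_set (Set.Ioo_subset_Ioo_left (max_le_max le_rfl hβ)))
    · rw [Set.Ioo_eq_empty (not_lt.2 hge)]; simp
  refine (setLIntegral_quantileFn_le hg0 h1 h2 hα.1).trans ?_
  refine (add_le_add le_rfl hc).trans ?_
  rw [← ENNReal.mul_le_mul_iff_right (a := 2) (by simp) (by simp), mul_add, two_mul
    (∫⁻ u in Set.Ioo α 1, ENNReal.ofReal (quantileFn P h u))]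
  exact add_le_add ha hb

end Quantile

section Density

lemma exists_simpleFunc_norm_sub_le {𝕜 : Type*} [RCLike 𝕜] {Z : Ω → 𝕜} (hZ : Measurable Z)
    (n : ℝ) {δ : ℝ} (hδ : 0 < δ) :
    ∃ Zs : SimpleFunc Ω 𝕜, ∀ ω,
      (‖Z ω‖ ≤ n → ‖Z ω - Zs ω‖ ≤ δ) ∧ (n < ‖Z ω‖ → Zs ω = 0) := by
  obtain ⟨t, ht⟩ := (isCompact_closedBall (0 : 𝕜) n).elim_finite_subcover
    (fun k : ℕ => Metric.ball (TopologicalSpace.denseSeq 𝕜 k) δ) (fun _ => Metric.isOpen_ball)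
    (fun x _ => by
      obtain ⟨_, hy, k, rfl⟩ := Metric.dense_iff.1 (TopologicalSpace.denseRange_denseSeq 𝕜) x δ hδ
      exact Set.mem_iUnion.2 ⟨k, Metric.mem_ball'.2 (Metric.mem_ball.1 hy)⟩)
  have hB : MeasurableSet {ω | ‖Z ω‖ ≤ n} := hZ.norm measurableSet_Iic
  refine ⟨((SimpleFunc.nearestPt (TopologicalSpace.denseSeq 𝕜) (t.sup id)).comp Z hZ).restrict
    {ω | ‖Z ω‖ ≤ n}, fun ω => ⟨fun hω => ?_, fun hω => ?_⟩⟩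
  · rw [SimpleFunc.restrict_apply _ hB, Set.indicator_of_mem (show ω ∈ {ω | ‖Z ω‖ ≤ n} from hω)]
    have hm : Z ω ∈ Metric.closedBall (0 : 𝕜) n := by simpa using hω
    obtain ⟨k, hk, hkb⟩ := Set.mem_iUnion₂.1 (ht hm)
    have h := SimpleFunc.edist_nearestPt_le (TopologicalSpace.denseSeq 𝕜) (Z ω)
      (Finset.le_sup (f := id) hk)
    rw [edist_dist, edist_dist, ENNReal.ofReal_le_ofReal_iff dist_nonneg] at h
    rw [← dist_eq_norm, dist_comm]
    exact h.trans (Metric.mem_ball'.1 hkb).le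
  · rw [SimpleFunc.restrict_apply _ hB]
    rw [Set.indicator_of_notMem (show ω ∉ {ω | ‖Z ω‖ ≤ n} from not_le.2 hω)]

lemma IsUniformRV.sigExt_ae_eq {P : Measure Ω} [IsProbabilityMeasure P] {U : Ω → ℝ}
    (hU : IsUniformRV P U) (σ : ℝ → ℝ) : ∀ᵐ ω ∂P, sigExt σ (U ω) = σ (U ω) := by
  filter_upwards [hU.ae_lt_one] with ω hω
  exact sigExt_of_mem ⟨(hU.2.1 ω).1, hω⟩

lemma sigmaPow_le_of_norm_le {P : Measure Ω} [IsProbabilityMeasure P] {σ : ℝ → ℝ}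
    (hσ : IsDistortion σ) {q : ℝ} (hq : 1 ≤ q) {𝕜 : Type*} [RCLike 𝕜] {Y W : Ω → 𝕜}
    {E : Set Ω} (hE : MeasurableSet E) {δ : ℝ≥0} {η : ℝ≥0∞}
    (hW : ∀ ω, (‖W ω‖₊ : ℝ≥0∞) ≤ 2 * (E.indicator (fun ω => (‖Y ω‖₊ : ℝ≥0∞)) ω + δ))
    (hη : ∀ V, IsUniformRV P V →
      ∫⁻ ω in E, ENNReal.ofReal (sigExt σ (V ω)) * (‖Y ω‖₊ : ℝ≥0∞) ^ q ∂P ≤ η) :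
    sigmaPow P σ q W ≤ 2 ^ q * 2 ^ (q - 1) * (η + (δ : ℝ≥0∞) ^ q) := by
  have hq0 : 0 < q := one_pos.trans_le hq
  refine iSup₂_le fun V hV => ?_
  have hs : Measurable fun ω => ENNReal.ofReal (sigExt σ (V ω)) :=
    hσ.measurable_ofReal_sigExt.comp hV.1
  calc ∫⁻ ω, ENNReal.ofReal (σ (V ω)) * (‖W ω‖₊ : ℝ≥0∞) ^ q ∂P
      ≤ ∫⁻ ω, 2 ^ q * 2 ^ (q - 1) *
          (ENNReal.ofReal (sigExt σ (V ω)) * (δ : ℝ≥0∞) ^ q + E.indicator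
            (fun ω => ENNReal.ofReal (sigExt σ (V ω)) * (‖Y ω‖₊ : ℝ≥0∞) ^ q) ω) ∂P := by
        refine lintegral_mono_ae ?_
        filter_upwards [hV.sigExt_ae_eq σ] with ω hω
        rw [← hω]
        have h1 : (‖W ω‖₊ : ℝ≥0∞) ^ q ≤ 2 ^ q * (2 ^ (q - 1) *
            (E.indicator (fun ω => (‖Y ω‖₊ : ℝ≥0∞)) ω ^ q + (δ : ℝ≥0∞) ^ q)) := by
          refine (ENNReal.rpow_le_rpow (hW ω) hq0.le).trans ?_
          rw [ENNReal.mul_rpow_of_nonneg _ _ hq0.le]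
          gcongr
          exact ENNReal.rpow_add_le_mul_rpow_add_rpow _ _ hq
        refine (mul_le_mul_right h1 _).trans (le_of_eq ?_)
        by_cases hωE : ω ∈ E
        · simp only [Set.indicator_of_mem hωE]; ring
        · simp only [Set.indicator_of_notMem hωE, ENNReal.zero_rpow_of_pos hq0]; ring
    _ = 2 ^ q * 2 ^ (q - 1) * ((δ : ℝ≥0∞) ^ q +
          ∫⁻ ω in E, ENNReal.ofReal (sigExt σ (V ω)) * (‖Y ω‖₊ : ℝ≥0∞) ^ q ∂P) := by
        rw [lintegral_const_mul' _ _ (ENNReal.mul_ne_top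
            (ENNReal.rpow_ne_top_of_nonneg hq0.le (by simp))
            (ENNReal.rpow_ne_top_of_nonneg (by linarith) (by simp))),
          lintegral_add_left (hs.mul_const _), lintegral_mul_const _ hs,
          hV.lintegral_comp hσ.measurable_ofReal_sigExt, hσ.lintegral_eq_one, one_mul,
          lintegral_indicator hE]
    _ ≤ _ := by
        rw [add_comm]
        gcongr
        exact hη V hV

end Density

/-- For `q ∈ (1,∞)`, simple functions (and hence `L^∞(P)`) are dense
in `(L*_{σ,q}(P), |·|*_{σ,q})`. -/
theorem statement18
    (P : Measure Ω) [IsProbabilityMeasure P]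
    (hrich : ∃ U : Ω → ℝ, IsUniformRV P U)
    {𝕂 : Type*} [RCLike 𝕂]
    (σ : ℝ → ℝ) (hσ : IsDistortion σ) (q : ℝ) (hq : 1 < q)
    (Z : Ω → 𝕂) (hZmeas : AEStronglyMeasurable Z P) (hZ : dualNormQ P σ q Z < ∞)
    (ε : ℝ≥0∞) (hε : 0 < ε) :
    ∃ Zs : SimpleFunc Ω 𝕂, dualNormQ P σ q (fun ω => Z ω - Zs ω) < ε := by
  have hq0 : 0 < q := one_pos.trans hq
  obtain ⟨Z', ⟨hZ'm, U, hU, hdom⟩, hZ'⟩ := by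
    simpa only [dualNormQ, iInf_lt_iff] using hZ
  set Zp := hZ'm.mk Z' with hZp
  have hZpm : Measurable Zp := hZ'm.stronglyMeasurable_mk.measurable
  set X : Ω → ℝ := fun ω => sigExt σ (U ω) * ‖Zp ω‖ with hX
  have hXm : Measurable X := (hσ.measurable_sigExt.comp hU.1).mul hZpm.norm
  have hX0 : ∀ ω, 0 ≤ X ω := fun ω => mul_nonneg (hσ.sigExt_nonneg _) (norm_nonneg _)
  have hXae : (fun ω => σ (U ω) * ‖Z' ω‖) =ᵐ[P] X := by
    filter_upwards [hU.sigExt_ae_eq σ, hZ'm.ae_eq_mk] with ω h1 h2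
    rw [← h1, h2]
  have hdomX : ∀ α ∈ Set.Ico (0 : ℝ) 1,
      ∫⁻ u in Set.Ioo α 1, ENNReal.ofReal (quantileFn P (fun ω => ‖Z ω‖) u) ≤
        ∫⁻ u in Set.Ioo α 1, ENNReal.ofReal (quantileFn P X u) := fun α hα => by
    rw [← avar_le_avar_iff hα.2, ← avar_congr hXae]
    exact hdom α hα
  obtain ⟨e, he0, heε⟩ : ∃ e : ℝ≥0, 0 < e ∧ (e : ℝ≥0∞) < ε := by
    obtain ⟨e, he0, he⟩ := ENNReal.lt_iff_exists_nnreal_btwn.1 hε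
    exact ⟨e, by exact_mod_cast he0, he⟩
  set C : ℝ≥0 := 2 ^ q * 2 ^ (q - 1) with hC
  have hC0 : 0 < C := by positivity
  have hCC : (C : ℝ≥0∞) = 2 ^ q * 2 ^ (q - 1) := by
    rw [hC, ENNReal.coe_mul, ENNReal.coe_rpow_of_ne_zero (by simp),
      ENNReal.coe_rpow_of_ne_zero (by simp)]
    simp
  set η : ℝ≥0 := e ^ q / (2 * C) with hη
  have hη0 : 0 < η := by positivity
  set δ : ℝ≥0 := η ^ (1 / q) with hδ
  have hδ0 : 0 < δ := by positivity
  have hδq : (δ : ℝ≥0∞) ^ q = η := by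
    rw [← ENNReal.coe_rpow_of_nonneg _ hq0.le, hδ, ← NNReal.rpow_mul, one_div_mul_cancel hq0.ne',
      NNReal.rpow_one]
  have hfin : ∀ V, IsUniformRV P V →
      ∫⁻ ω, ENNReal.ofReal (sigExt σ (V ω)) * ((‖Zp ω‖₊ ^ q : ℝ≥0) : ℝ≥0∞) ∂P ≠ ∞ := by
    intro V hV
    have hpow : sigmaPow P σ q Z' ≠ ∞ := fun h => by
      rw [sigmaNorm, h, ENNReal.top_rpow_of_pos (by positivity)] at hZ'
      exact lt_irrefl _ hZ'
    refine ne_top_of_le_ne_top hpow (le_trans (le_of_eq ?_)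
      (le_iSup₂ (f := fun (U : Ω → ℝ) (_ : IsUniformRV P U) =>
        ∫⁻ ω, ENNReal.ofReal (σ (U ω)) * (‖Z' ω‖₊ : ℝ≥0∞) ^ q ∂P) V hV))
    refine lintegral_congr_ae ?_
    filter_upwards [hV.sigExt_ae_eq σ, hZ'm.ae_eq_mk] with ω h1 h2
    rw [h1, h2, ENNReal.coe_rpow_of_nonneg _ hq0.le]
  have hNm : Measurable fun ω => ⌊X ω⌋₊ := Nat.measurable_floor.comp hXm
  obtain ⟨m, hm⟩ := exists_forall_setLIntegral_sigExt_mul_le hσ hrich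
    (hZpm.nnnorm.pow_const q) hfin hNm (η := (η : ℝ≥0∞)) (by exact_mod_cast hη0.ne')
  set E : Set Ω := {ω | m ≤ ⌊X ω⌋₊} with hE
  have hEm : MeasurableSet E := hNm measurableSet_Ici
  obtain ⟨n, hn⟩ := exists_measure_le_of_quantile_dominated hZmeas.norm.aemeasurable
    (Filter.Eventually.of_forall hX0) hdomX (Nat.cast_nonneg m)
  obtain ⟨Zs, hZs⟩ := exists_simpleFunc_norm_sub_le hZmeas.stronglyMeasurable_mk.measurable n
    (show (0 : ℝ) < δ from hδ0)
  set w : Ω → ℝ := fun ω => 2 * (E.indicator (fun ω => ‖Zp ω‖) ω + δ) with hw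
  have hind0 : ∀ ω, 0 ≤ E.indicator (fun ω => ‖Zp ω‖) ω :=
    fun ω => Set.indicator_nonneg (fun _ _ => norm_nonneg _) ω
  have hw0 : ∀ ω, 0 ≤ w ω := fun ω =>
    mul_nonneg two_pos.le (add_nonneg (hind0 ω) δ.coe_nonneg)
  have hwm : Measurable w := ((hZpm.norm.indicator hEm).add_const _).const_mul _
  set W : Ω → 𝕂 := fun ω => (w ω : 𝕂) with hWdef
  have hWn : ∀ ω, ‖W ω‖ = w ω := fun ω => by
    rw [hWdef, RCLike.norm_ofReal, abs_of_nonneg (hw0 ω)]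
  have hpow : sigmaPow P σ q W ≤ C * (η + η) := by
    rw [hCC]
    refine (sigmaPow_le_of_norm_le hσ hq.le (Y := Zp) (δ := δ) (η := η) hEm (fun ω => ?_)
      fun V hV => ?_).trans_eq (by rw [hδq])
    · rw [← ENNReal.ofReal_coe_nnreal, coe_nnnorm, hWn, hw]
      by_cases hωE : ω ∈ E
      · simp only [Set.indicator_of_mem hωE]
        rw [ENNReal.ofReal_mul two_pos.le, ENNReal.ofReal_add (norm_nonneg _) δ.coe_nonneg,
          ENNReal.ofReal_coe_nnreal, ← coe_nnnorm, ENNReal.ofReal_coe_nnreal, ENNReal.ofReal_ofNat]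
      · simp only [Set.indicator_of_notMem hωE, zero_add]
        rw [ENNReal.ofReal_mul two_pos.le, ENNReal.ofReal_coe_nnreal, ENNReal.ofReal_ofNat]
    · refine (le_of_eq ?_).trans (hm V hV)
      simp_rw [ENNReal.coe_rpow_of_nonneg _ hq0.le]
  have hWm : AEStronglyMeasurable W P :=
    (RCLike.measurable_ofReal.comp hwm).aestronglyMeasurable
  have hWdom : SigmaDominates P σ W fun ω => Z ω - Zs ω := by
    refine ⟨U, hU, fun α hα => ?_⟩
    rw [avar_le_avar_iff hα.2]
    refine setLIntegral_quantileFn_le_of_dominated hσ hU (f := fun ω => ‖Z ω‖) (X := X) (m := m)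
      (n := n) (δ := δ) (Filter.Eventually.of_forall fun ω => norm_nonneg _)
      (Filter.Eventually.of_forall hX0) hδ0 ?_ ?_ ?_ ?_ hn hdomX hα
    · filter_upwards [hZmeas.ae_eq_mk] with ω hω h
      rw [hω] at h ⊢
      exact (hZs ω).1 h
    · filter_upwards [hZmeas.ae_eq_mk] with ω hω
      rw [hω]
      rcases le_or_gt ‖hZmeas.mk Z ω‖ n with h | h
      · exact ((hZs ω).1 h).trans (le_add_of_nonneg_left (norm_nonneg _))
      · rw [(hZs ω).2 h, sub_zero]
        exact le_add_of_nonneg_right δ.coe_nonneg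
    · filter_upwards [hU.sigExt_ae_eq σ] with ω hω hmX
      have hωE : ω ∈ E := Nat.le_floor hmX.le
      rw [hWn, ← hω, hw, hX]
      simp only [Set.indicator_of_mem hωE]
      nlinarith [mul_nonneg (hσ.sigExt_nonneg (U ω)) δ.coe_nonneg]
    · filter_upwards [hU.sigExt_ae_eq σ] with ω hω
      rw [hWn, ← hω, hw]
      nlinarith [mul_nonneg (hσ.sigExt_nonneg (U ω)) (hind0 ω)]
  refine ⟨Zs, (iInf₂_le W ⟨hWm, hWdom⟩).trans_lt ?_⟩
  have hCη : (C : ℝ≥0∞) * (η + η) = (e : ℝ≥0∞) ^ q := by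
    rw [← ENNReal.coe_rpow_of_nonneg _ hq0.le]
    norm_cast
    rw [hη]
    field_simp
    ring
  calc sigmaNorm P σ q W ≤ ((e : ℝ≥0∞) ^ q) ^ (1 / q) :=
        ENNReal.rpow_le_rpow (hpow.trans_eq hCη) (by positivity)
    _ = e := by rw [← ENNReal.rpow_mul, mul_one_div_cancel hq0.ne', ENNReal.rpow_one]
    _ < ε := heε

end
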